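/- arXiv:1305.1867 — 3 statements merged into one kernel-verified Lean document; each statement's English description precedes it below -/
import Mathlib

section
/- If n is a weak Carmichael number and p and q are two distinct primes dividing n, then q does not divide p − 1. -/
/-- The sum `∑_{1 ≤ k ≤ n−1, gcd(k,n)=1} k^(n−1)`. -/
def carmSum (n : ℕ) : ℕ :=
  ∑ k ∈ Finset.filter (fun k => Nat.Coprime k n) (Finset.range n), k ^ (n - 1)

/-- A composite positive integer `n` is a weak Carmichael number if
`∑_{1 ≤ k ≤ n−1, gcd(k,n)=1} k^(n−1) ≡ φ(n) (mod n)`. -/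
def IsWeakCarmichael (n : ℕ) : Prop :=
  1 < n ∧ ¬ n.Prime ∧ carmSum n ≡ n.totient [MOD n]

theorem natCast_carmSum (n : ℕ) [NeZero n] :
    (carmSum n : ZMod n) = ∑ u : (ZMod n)ˣ, (u : ZMod n) ^ (n - 1) := by
  unfold carmSum
  push_cast
  symm
  refine Finset.sum_bij (fun u _ => (u : ZMod n).val) ?_ ?_ ?_ ?_
  · intro u _
    simpa [ZMod.val_lt] using ZMod.val_coe_unit_coprime u
  · intro u _ v _ huv
    exact Units.ext (ZMod.val_injective n huv)
  · intro k hk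
    simp only [Finset.mem_filter, Finset.mem_range] at hk
    exact ⟨ZMod.unitOfCoprime k hk.2, Finset.mem_univ _, by
      simp [ZMod.val_natCast, Nat.mod_eq_of_lt hk.1]⟩
  · intro u _
    simp

/-- If `p - 1` does not divide `n - 1`, then every power of the prime `p` dividing `n` divides
the power sum. -/
theorem pow_dvd_carmSum {n p e : ℕ} [NeZero n] (hp : p.Prime) (hpn : p ∣ n) (he : p ^ e ∣ n)
    (h : ¬ p - 1 ∣ n - 1) : p ^ e ∣ carmSum n := by
  have : Fact p.Prime := ⟨hp⟩
  have hg : ∃ g : (ZMod p)ˣ, g ^ (n - 1) ≠ 1 := by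
    by_contra! hg
    have := (FiniteField.forall_pow_eq_one_iff (ZMod p) (n - 1)).1 hg
    rw [ZMod.card] at this
    exact h this
  obtain ⟨g, hg⟩ := hg
  obtain ⟨v, rfl⟩ := ZMod.unitsMap_surjective hpn g
  have hinv : (v : ZMod n) ^ (n - 1) * (carmSum n : ZMod n) = carmSum n := by
    rw [natCast_carmSum, Finset.mul_sum]
    refine Fintype.sum_equiv (Equiv.mulLeft v) _ _ fun u => ?_
    simp [mul_pow]
  set k : ℤ := ((v : ZMod n).val : ℤ) with hk
  have hkv : (k : ZMod n) = v := by simp [hk]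
  have hdvd : (n : ℤ) ∣ (k ^ (n - 1) - 1) * carmSum n := by
    rw [← ZMod.intCast_zmod_eq_zero_iff_dvd]
    push_cast
    rw [hkv, sub_mul, hinv, one_mul, sub_self]
  have hnot : ¬ (p : ℤ) ∣ k ^ (n - 1) - 1 := by
    rw [← ZMod.intCast_zmod_eq_zero_iff_dvd]
    push_cast
    intro h0
    apply hg
    ext
    have hkp : (k : ZMod p) = ZMod.castHom hpn (ZMod p) v := by
      rw [← hkv, map_intCast]
    rw [hkp] at h0
    simpa [ZMod.unitsMap_def] using sub_eq_zero.1 h0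
  have hcop : IsCoprime ((p : ℤ) ^ e) (k ^ (n - 1) - 1) :=
    IsCoprime.pow_left ((Nat.prime_iff_prime_int.1 hp).coprime_iff_not_dvd.2 hnot)
  have hpe : ((p : ℤ) ^ e) ∣ (n : ℤ) := by exact_mod_cast he
  exact_mod_cast hcop.dvd_of_dvd_mul_left (hpe.trans hdvd)

/-- If the full power of `p` in `n` divides `φ n`, then `p ∣ q - 1` for some prime `q ∣ n`. -/
theorem exists_prime_dvd_sub_one {n p e m : ℕ} (hp : p.Prime) (hpn : p ∣ n) (hn : n ≠ 0)
    (hm : ¬ p ∣ m) (hnm : n = p ^ e * m) (h : p ^ e ∣ n.totient) :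
    ∃ q, q.Prime ∧ q ∣ n ∧ p ∣ q - 1 := by
  have key := Nat.totient_mul_prod_primeFactors n
  have hprod : p ∣ ∏ q ∈ n.primeFactors, q :=
    Finset.dvd_prod_of_mem _ (Nat.mem_primeFactors.2 ⟨hp, hpn, hn⟩)
  have hd := mul_dvd_mul h hprod
  rw [key] at hd
  nth_rewrite 1 [hnm] at hd
  rw [mul_assoc] at hd
  have hd' := Nat.dvd_of_mul_dvd_mul_left (pow_pos hp.pos e) hd
  obtain ⟨q, hq, hpq⟩ :=
    (hp.prime.dvd_finsetProd_iff _).1 ((hp.dvd_mul.1 hd').resolve_left hm)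
  exact ⟨q, Nat.prime_of_mem_primeFactors hq, Nat.dvd_of_mem_primeFactors hq, hpq⟩

theorem not_dvd_of_sub_one_dvd {n p q : ℕ} (hn : 1 < n) (hq : q.Prime) (hqn : q ∣ n)
    (h : p - 1 ∣ n - 1) : ¬ q ∣ p - 1 := by
  intro hqp
  have h1 : q ∣ n - (n - 1) := Nat.dvd_sub hqn (hqp.trans h)
  rw [Nat.sub_sub_self hn.le] at h1
  exact hq.one_lt.ne' (Nat.dvd_one.1 h1)

/-- A Korselt-type criterion: `p - 1 ∣ n - 1` for each prime divisor `p` of a weak Carmichael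
number `n`. -/
theorem IsWeakCarmichael.sub_one_dvd {n : ℕ} (h : IsWeakCarmichael n) {p : ℕ} (hp : p.Prime)
    (hpn : p ∣ n) : p - 1 ∣ n - 1 := by
  have ⟨hn, _, hmod⟩ := h
  have hn0 : n ≠ 0 := by omega
  have : NeZero n := ⟨hn0⟩
  by_contra hnd
  obtain ⟨e, m, hm, hnm⟩ := Nat.exists_eq_pow_mul_and_not_dvd hn0 p hp.ne_one
  have he : p ^ e ∣ n := ⟨m, hnm⟩
  have htot : p ^ e ∣ n.totient :=
    (hmod.dvd_iff he).1 (pow_dvd_carmSum hp hpn he hnd)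
  obtain ⟨q, hq, hqn, hpq⟩ := exists_prime_dvd_sub_one hp hpn hn0 hm hnm htot
  have hlt : p < q := by
    have := Nat.le_of_dvd (Nat.sub_pos_of_lt hq.one_lt) hpq
    have := hq.pos
    omega
  have hle := Nat.le_of_dvd (Nat.pos_of_ne_zero hn0) hqn
  exact not_dvd_of_sub_one_dvd hn hp hpn (h.sub_one_dvd hq hqn) hpq
termination_by n - p

theorem stmt_8 (n p q : ℕ) (h : IsWeakCarmichael n) (hp : p.Prime)
    (hq : q.Prime) (hpn : p ∣ n) (hqn : q ∣ n) (hpq : p ≠ q) :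
    ¬ q ∣ (p - 1) :=
  not_dvd_of_sub_one_dvd h.1 hq hqn (h.sub_one_dvd hp hpn)
end

section
/- Let p and q be two distinct odd primes with p < q such that q − 1 is not divisible by p. Let u be the smallest positive integer with p^u ≡ 1 (mod q−1) and let v be the smallest positive integer with q^v ≡ 1 (mod p−1). Then for positive integers a and b, the number p^a·q^b is a weak Carmichael number if and only if u divides a and v divides b. -/
/-- The sum of the `N`-th powers of the totatives of `n`. -/
def totativePowSum (n N : ℕ) : ℕ :=
  ∑ k ∈ Finset.filter (fun k => Nat.Coprime k n) (Finset.range n), k ^ N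

theorem sum_coprime_eq_sum_units {M : Type*} [AddCommMonoid M] (n : ℕ) [NeZero n] (F : ℕ → M) :
    ∑ k ∈ Finset.filter (fun k => Nat.Coprime k n) (Finset.range n), F k =
      ∑ x : (ZMod n)ˣ, F (x : ZMod n).val := by
  symm
  refine Finset.sum_bij (fun x _ => (x : ZMod n).val) ?_ ?_ ?_ ?_
  · intro x _
    simp only [Finset.mem_filter, Finset.mem_range]
    exact ⟨ZMod.val_lt _, ZMod.val_coe_unit_coprime x⟩
  · intro x _ y _ h
    exact Units.ext (ZMod.val_injective n h)
  · intro k hk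
    simp only [Finset.mem_filter, Finset.mem_range] at hk
    refine ⟨ZMod.unitOfCoprime k hk.2, Finset.mem_univ _, ?_⟩
    rw [ZMod.coe_unitOfCoprime, ZMod.val_cast_of_lt hk.1]
  · intro x _
    rfl

theorem totativePowSum_cast_self (n N : ℕ) [NeZero n] :
    (totativePowSum n N : ZMod n) = ∑ x : (ZMod n)ˣ, (x : ZMod n) ^ N := by
  rw [totativePowSum, sum_coprime_eq_sum_units, Nat.cast_sum]
  simp

theorem totativePowSum_mul_modEq {m k : ℕ} (hm : m ≠ 0) (hk : k ≠ 0) (h : m.Coprime k) (N : ℕ) :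
    totativePowSum (m * k) N ≡ k.totient * totativePowSum m N [MOD m] := by
  have : NeZero m := ⟨hm⟩
  have : NeZero k := ⟨hk⟩
  have : NeZero (m * k) := ⟨mul_ne_zero hm hk⟩
  rw [← ZMod.natCast_eq_natCast_iff, Nat.cast_mul, totativePowSum_cast_self, totativePowSum,
    sum_coprime_eq_sum_units, Nat.cast_sum]
  let e : (ZMod (m * k))ˣ ≃* (ZMod m)ˣ × (ZMod k)ˣ :=
    (Units.mapEquiv (ZMod.chineseRemainder h).toMulEquiv).trans MulEquiv.prodUnits
  have he : ∀ x : (ZMod (m * k))ˣ,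
      (((x : ZMod (m * k)).val ^ N : ℕ) : ZMod m) = ((e x).1 : ZMod m) ^ N := by
    intro x
    have h1 : ((e x).1 : ZMod m) = (ZMod.chineseRemainder h (x : ZMod (m * k))).1 := rfl
    have h2 : ZMod.chineseRemainder h (x : ZMod (m * k)) =
        (((x : ZMod (m * k)).val : ℕ) : ZMod m × ZMod k) := by
      rw [← map_natCast (ZMod.chineseRemainder h), ZMod.natCast_zmod_val]
    rw [h1, h2, Prod.fst_natCast, Nat.cast_pow]
  have hsum : ∑ x : (ZMod (m * k))ˣ, ((e x).1 : ZMod m) ^ N =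
      ∑ y : (ZMod m)ˣ × (ZMod k)ˣ, (y.1 : ZMod m) ^ N :=
    Equiv.sum_comp e.toEquiv fun y => (y.1 : ZMod m) ^ N
  rw [Finset.sum_congr rfl fun x _ => he x, hsum, Fintype.sum_prod_type]
  simp [ZMod.card_units_eq_totient, Finset.mul_sum]

theorem sum_range_mul_eq {M : Type*} [AddCommMonoid M] (f : ℕ → M) (m k : ℕ) :
    ∑ x ∈ Finset.range (m * k), f x =
      ∑ x ∈ Finset.range m, ∑ i ∈ Finset.range k, f (x + m * i) := by
  rw [Finset.sum_comm]
  induction k with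
  | zero => simp
  | succ k ih =>
    rw [Nat.mul_succ, Finset.sum_range_add, ih, Finset.sum_range_succ]
    simp [add_comm]

theorem sum_add_mul_pow_modEq {p : ℕ} (hp : Odd p) {a : ℕ} (ha : 0 < a) (x N : ℕ) :
    ∑ i ∈ Finset.range p, (x + p ^ a * i) ^ N ≡ p * x ^ N [MOD p ^ (a + 1)] := by
  have hexp (i : ℕ) := (Polynomial.powAddExpansion x (p ^ a * i) N).2
  have hdvd : p ∣ ∑ i ∈ Finset.range p, i := by
    have h2 : p ∣ (∑ i ∈ Finset.range p, i) * 2 := by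
      rw [Finset.sum_range_id_mul_two]
      exact dvd_mul_right _ _
    exact Nat.Coprime.dvd_of_dvd_mul_right hp.coprime_two_right h2
  rw [Finset.sum_congr rfl fun i _ => hexp i, Finset.sum_add_distrib, Finset.sum_add_distrib]
  have h1 : p ^ (a + 1) ∣ ∑ i ∈ Finset.range p, N * x ^ (N - 1) * (p ^ a * i) := by
    rw [← Finset.mul_sum, ← Finset.mul_sum, pow_succ]
    exact (mul_dvd_mul_left _ hdvd).mul_left _
  have h2 : p ^ (a + 1) ∣ ∑ i ∈ Finset.range p,
      (Polynomial.powAddExpansion x (p ^ a * i) N).1 * (p ^ a * i) ^ 2 := by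
    refine Finset.dvd_sum fun i _ => Dvd.dvd.mul_left ?_ _
    rw [mul_pow, ← pow_mul]
    exact (pow_dvd_pow p (by omega)).mul_right _
  simpa using ((Nat.ModEq.refl (p * x ^ N)).add
    ((Nat.modEq_zero_iff_dvd.2 h1))).add (Nat.modEq_zero_iff_dvd.2 h2)

theorem totativePowSum_pow_succ_modEq {p : ℕ} (hp : Odd p) {a : ℕ} (ha : 0 < a) (N : ℕ) :
    totativePowSum (p ^ (a + 1)) N ≡ p * totativePowSum (p ^ a) N [MOD p ^ (a + 1)] := by
  have hcop (x i : ℕ) : (x + p ^ a * i).Coprime (p ^ (a + 1)) ↔ x.Coprime (p ^ a) := by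
    rw [Nat.coprime_pow_right_iff (Nat.succ_pos a), Nat.coprime_pow_right_iff ha]
    obtain ⟨c, rfl⟩ := Nat.exists_eq_add_of_lt ha
    rw [zero_add, pow_succ', mul_assoc, Nat.coprime_add_mul_left_left]
  unfold totativePowSum
  rw [Finset.sum_filter, Finset.sum_filter]
  conv_lhs => rw [pow_succ p a, sum_range_mul_eq, ← pow_succ]
  simp only [hcop]
  rw [Finset.mul_sum]
  refine Nat.ModEq.sum fun x _ => ?_
  split_ifs with h
  · exact sum_add_mul_pow_modEq hp ha x N
  · simp [Nat.ModEq.refl]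

theorem totativePowSum_prime_modEq_iff {p : ℕ} (hp : p.Prime) (N : ℕ) :
    totativePowSum p N ≡ p.totient [MOD p] ↔ p - 1 ∣ N := by
  have := Fact.mk hp
  rw [← ZMod.natCast_eq_natCast_iff, totativePowSum_cast_self, Nat.totient_prime hp,
    Nat.cast_sub hp.one_le, ZMod.natCast_self, Nat.cast_one, zero_sub]
  have h := FiniteField.sum_pow_units (ZMod p) N
  rw [ZMod.card] at h
  rw [h]
  split_ifs with hd <;> simp [hd]

theorem totativePowSum_prime_pow_modEq_iff {p : ℕ} (hp : p.Prime) (hodd : Odd p) {a : ℕ}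
    (ha : 0 < a) (N : ℕ) :
    totativePowSum (p ^ a) N ≡ (p ^ a).totient [MOD p ^ a] ↔ p - 1 ∣ N := by
  induction a, Nat.succ_le_of_lt ha using Nat.le_induction with
  | base => rw [Nat.succ_eq_add_one, zero_add, pow_one, totativePowSum_prime_modEq_iff hp]
  | succ a h ih =>
    have h' : 0 < a := h
    have hS := totativePowSum_pow_succ_modEq hodd h' N
    have ht : (p ^ (a + 1)).totient = p * (p ^ a).totient := by
      rw [pow_succ', Nat.totient_mul_of_prime_of_dvd hp (dvd_pow_self p h'.ne')]
    rw [← ih h', ht]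
    constructor
    · intro hm
      have := hS.symm.trans hm
      rw [pow_succ'] at this
      exact Nat.ModEq.mul_left_cancel' hp.ne_zero this
    · intro hm
      refine hS.trans ?_
      rw [pow_succ']
      exact hm.mul_left' p

theorem totativePowSum_prime_pow_mul_modEq_iff {p : ℕ} (hp : p.Prime) (hodd : Odd p) {a k : ℕ}
    (ha : 0 < a) (hk : k ≠ 0) (hpk : p.Coprime k) (hpt : p.Coprime k.totient) (N : ℕ) :
    totativePowSum (p ^ a * k) N ≡ (p ^ a * k).totient [MOD p ^ a] ↔ p - 1 ∣ N := by
  have hS := totativePowSum_mul_modEq (pow_ne_zero a hp.ne_zero) hk (hpk.pow_left a) N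
  rw [← totativePowSum_prime_pow_modEq_iff hp hodd ha, Nat.totient_mul (hpk.pow_left a),
    mul_comm (p ^ a).totient]
  constructor
  · intro hm
    exact Nat.ModEq.cancel_left_of_coprime (hpt.pow_left a) (hS.symm.trans hm)
  · intro hm
    exact hS.trans (hm.mul_left _)

theorem pred_dvd_pow_mul_sub_one_iff {p : ℕ} (hp : 0 < p) (a : ℕ) {k : ℕ} (hk : 0 < k) :
    p - 1 ∣ p ^ a * k - 1 ↔ k ≡ 1 [MOD p - 1] := by
  have h1 : p ^ a * k ≡ k [MOD p - 1] := by
    have hp1 : p ≡ 1 [MOD p - 1] := ((Nat.modEq_iff_dvd' hp).2 dvd_rfl).symm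
    simpa using (hp1.pow a).mul_right k
  have hpos : 1 ≤ p ^ a * k := Nat.mul_pos (Nat.pow_pos hp) hk
  rw [← Nat.modEq_iff_dvd' hpos]
  exact ⟨fun h => (h.trans h1).symm, fun h => (h1.trans h).symm⟩

theorem pow_modEq_one_iff_dvd_of_least {m x u : ℕ}
    (hu : 0 < u ∧ x ^ u ≡ 1 [MOD m] ∧ ∀ k : ℕ, 0 < k → x ^ k ≡ 1 [MOD m] → u ≤ k) (a : ℕ) :
    x ^ a ≡ 1 [MOD m] ↔ u ∣ a := by
  obtain ⟨hpos, hone, hmin⟩ := hu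
  have hcast (k : ℕ) : x ^ k ≡ 1 [MOD m] ↔ (x : ZMod m) ^ k = 1 := by
    rw [← ZMod.natCast_eq_natCast_iff, Nat.cast_pow, Nat.cast_one]
  have hord : orderOf (x : ZMod m) = u := by
    have hdvd := orderOf_dvd_of_pow_eq_one ((hcast u).1 hone)
    exact le_antisymm (Nat.le_of_dvd hpos hdvd)
      (hmin _ (Nat.pos_of_dvd_of_pos hdvd hpos) ((hcast _).2 (pow_orderOf_eq_one _)))
  rw [hcast, ← orderOf_dvd_iff_pow_eq_one, hord]

theorem stmt_9 (p q u v : ℕ) (hp : p.Prime) (hq : q.Prime) (hpodd : Odd p)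
    (hqodd : Odd q) (hlt : p < q) (hnd : ¬ p ∣ (q - 1))
    (hu : 0 < u ∧ p ^ u ≡ 1 [MOD q - 1] ∧
      ∀ m : ℕ, 0 < m → p ^ m ≡ 1 [MOD q - 1] → u ≤ m)
    (hv : 0 < v ∧ q ^ v ≡ 1 [MOD p - 1] ∧
      ∀ m : ℕ, 0 < m → q ^ m ≡ 1 [MOD p - 1] → v ≤ m)
    (a b : ℕ) (ha : 0 < a) (hb : 0 < b) :
    IsWeakCarmichael (p ^ a * q ^ b) ↔ u ∣ a ∧ v ∣ b := by
  have hpq : p.Coprime q := (Nat.coprime_primes hp hq).2 hlt.ne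
  have hpa : 1 < p ^ a := Nat.one_lt_pow ha.ne' hp.one_lt
  have hqb : 1 < q ^ b := Nat.one_lt_pow hb.ne' hq.one_lt
  have hqp : ¬ q ∣ p - 1 := fun h => by
    have := Nat.le_of_dvd (Nat.sub_pos_of_lt hp.one_lt) h
    omega
  have hpt : p.Coprime (q ^ b).totient := by
    rw [Nat.totient_prime_pow hq hb]
    exact (hpq.pow_right _).mul_right ((Nat.Prime.coprime_iff_not_dvd hp).2 hnd)
  have hqt : q.Coprime (p ^ a).totient := by
    rw [Nat.totient_prime_pow hp ha]
    exact (hpq.symm.pow_right _).mul_right ((Nat.Prime.coprime_iff_not_dvd hq).2 hqp)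
  have hmodp := totativePowSum_prime_pow_mul_modEq_iff hp hpodd ha (by omega)
    (hpq.pow_right b) hpt (p ^ a * q ^ b - 1)
  have hmodq := totativePowSum_prime_pow_mul_modEq_iff hq hqodd hb (by omega)
    (hpq.symm.pow_right a) hqt (p ^ a * q ^ b - 1)
  rw [pred_dvd_pow_mul_sub_one_iff hp.pos a (by omega),
    pow_modEq_one_iff_dvd_of_least hv] at hmodp
  rw [mul_comm (p ^ a), pred_dvd_pow_mul_sub_one_iff hq.pos b (by omega),
    pow_modEq_one_iff_dvd_of_least hu, mul_comm (q ^ b)] at hmodq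
  have hsum : carmSum (p ^ a * q ^ b) = totativePowSum (p ^ a * q ^ b) (p ^ a * q ^ b - 1) := rfl
  rw [IsWeakCarmichael, hsum,
    ← Nat.modEq_and_modEq_iff_modEq_mul (Nat.Coprime.pow a b hpq), hmodp, hmodq]
  constructor
  · rintro ⟨-, -, hvb, hua⟩
    exact ⟨hua, hvb⟩
  · rintro ⟨hua, hvb⟩
    exact ⟨one_lt_mul'' hpa hqb,
      Nat.not_prime_mul hpa.ne' hqb.ne', hvb, hua⟩
end

section
/- Let n be a composite positive integer and let F(n) denote the number of residues a with 1 ≤ a ≤ n and a^{n−1} ≡ 1 (mod n). Then: (i) if n is odd, n is a weak Carmichael number if and only if F(n) = ∏_{p | n} (p − 1), the product being over the distinct primes p dividing n; and (ii) n is a Carmichael number if and only if F(n) = φ(n). -/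
/-- A composite positive integer `n` is a Carmichael number if
`a^(n−1) ≡ 1 (mod n)` for every integer `a` coprime to `n`. -/
def IsCarmichael (n : ℕ) : Prop :=
  1 < n ∧ ¬ n.Prime ∧ ∀ a : ℕ, Nat.Coprime a n → a ^ (n - 1) ≡ 1 [MOD n]

/-- `F n` is the number of residues `a` with `1 ≤ a ≤ n` and
`a^(n−1) ≡ 1 (mod n)` (the number of Fermat liars for `n`). -/
def F (n : ℕ) : ℕ :=
  ((Finset.Icc 1 n).filter (fun a => a ^ (n - 1) % n = 1 % n)).card

/-- `F n` counts the kernel of `x ↦ x ^ (n - 1)` on `(ZMod n)ˣ`. -/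
theorem F_eq_card_units (n : ℕ) (hn : 1 < n) [NeZero n] :
    F n = (Finset.univ.filter fun u : (ZMod n)ˣ => u ^ (n - 1) = 1).card := by
  have : Fact (1 < n) := ⟨hn⟩
  unfold F
  symm
  refine Finset.card_bij (fun u _ => (u : ZMod n).val) ?_ ?_ ?_
  · intro u hu
    simp only [Finset.mem_filter, Finset.mem_univ, true_and] at hu
    simp only [Finset.mem_filter, Finset.mem_Icc]
    refine ⟨⟨?_, (ZMod.val_lt _).le⟩, ?_⟩
    · exact Nat.pos_of_ne_zero fun h => u.ne_zero ((ZMod.val_eq_zero _).1 h)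
    · change _ ≡ _ [MOD n]
      rw [← ZMod.natCast_eq_natCast_iff]
      push_cast
      rw [ZMod.natCast_zmod_val, ← Units.val_pow_eq_pow_val, hu, Units.val_one]
  · intro u _ v _ h
    exact Units.ext (ZMod.val_injective n h)
  · intro a ha
    simp only [Finset.mem_filter, Finset.mem_Icc] at ha
    obtain ⟨⟨h1, h2⟩, h3⟩ := ha
    have h4 : (a : ZMod n) ^ (n - 1) = 1 := by
      have h5 : a ^ (n - 1) ≡ 1 [MOD n] := h3
      rw [← ZMod.natCast_eq_natCast_iff] at h5
      simpa using h5
    have hu : IsUnit (a : ZMod n) := IsUnit.of_pow_eq_one h4 (by lia)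
    have hlt : a < n := by
      refine lt_of_le_of_ne h2 ?_
      rintro rfl
      simp at hu
    refine ⟨hu.unit, ?_, ?_⟩
    · simp only [Finset.mem_filter, Finset.mem_univ, true_and]
      exact Units.ext (by simpa using h4)
    · simp [ZMod.val_cast_of_lt hlt]

theorem carmSum_cast (n : ℕ) [NeZero n] :
    (carmSum n : ZMod n) = ∑ u : (ZMod n)ˣ, ((u ^ (n - 1) : (ZMod n)ˣ) : ZMod n) := by
  unfold carmSum
  push_cast
  symm
  refine Finset.sum_bij (fun u _ => (u : ZMod n).val) ?_ ?_ ?_ ?_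
  · intro u _
    simp only [Finset.mem_filter, Finset.mem_range]
    exact ⟨ZMod.val_lt _, ZMod.val_coe_unit_coprime u⟩
  · intro u _ v _ h
    exact Units.ext (ZMod.val_injective n h)
  · intro a ha
    simp only [Finset.mem_filter, Finset.mem_range] at ha
    exact ⟨ZMod.unitOfCoprime a ha.2, Finset.mem_univ _, by
      simp [ZMod.val_cast_of_lt ha.1]⟩
  · intro u _
    simp

theorem prod_primeFactors_totient (n : ℕ) :
    (∏ p ∈ n.primeFactors, p).totient = ∏ p ∈ n.primeFactors, (p - 1) := by
  have hpos : 0 < ∏ p ∈ n.primeFactors, p :=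
    Finset.prod_pos fun p hp => (Nat.prime_of_mem_primeFactors hp).pos
  have h := Nat.totient_mul_prod_primeFactors (∏ p ∈ n.primeFactors, p)
  rw [Nat.primeFactors_prod fun p hp => Nat.prime_of_mem_primeFactors hp, mul_comm] at h
  exact Nat.eq_of_mul_eq_mul_left hpos h

/-- Elements of `ZMod n` congruent to `1` modulo the radical of `n` have order dividing `n`. -/
theorem pow_eq_one_of_castHom_eq_one (n : ℕ) [NeZero n] (x : ZMod n)
    (hx : ZMod.castHom (Nat.prod_primeFactors_dvd n) (ZMod (∏ p ∈ n.primeFactors, p)) x = 1) :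
    x ^ n = 1 := by
  obtain ⟨a, rfl⟩ := ZMod.intCast_surjective x
  have hr : ((∏ p ∈ n.primeFactors, p : ℕ) : ℤ) ∣ a - 1 := by
    rw [← ZMod.intCast_zmod_eq_zero_iff_dvd, Int.cast_sub, Int.cast_one, sub_eq_zero]
    rwa [map_intCast] at hx
  have key : (n : ℤ) ∣ a ^ n - 1 := by
    rw [Int.natCast_dvd, Nat.dvd_iff_prime_pow_dvd_dvd]
    intro p k hp hpk
    rw [← Int.natCast_dvd]
    rcases k.eq_zero_or_pos with rfl | hk
    · simp
    have hpn : p ∣ n := (dvd_pow_self p hk.ne').trans hpk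
    have hpr : (p : ℤ) ∣ a - 1 :=
      (Int.natCast_dvd_natCast.2 (Finset.dvd_prod_of_mem (fun p => p)
        (Nat.mem_primeFactors.2 ⟨hp, hpn, NeZero.ne n⟩))).trans hr
    have h1 := dvd_sub_pow_of_dvd_sub hpr k
    rw [one_pow] at h1
    obtain ⟨m, hm⟩ := hpk
    have h2 : a ^ (p ^ k) - 1 ∣ a ^ n - 1 := by
      conv_rhs => rw [hm, pow_mul]
      exact sub_one_dvd_pow_sub_one _ _
    push_cast
    exact ((pow_dvd_pow _ (Nat.le_succ k)).trans h1).trans h2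
  rw [← ZMod.intCast_zmod_eq_zero_iff_dvd] at key
  push_cast at key
  exact sub_eq_zero.1 key

theorem pow_eq_one_of_unitsMap_eq_one (n : ℕ) [NeZero n] (u : (ZMod n)ˣ)
    (hu : ZMod.unitsMap (Nat.prod_primeFactors_dvd n) u = 1) : u ^ n = 1 :=
  Units.ext (pow_eq_one_of_castHom_eq_one n u (congrArg Units.val hu))

/-- `F n` attains `∏ (p - 1)` iff `n - 1` kills the unit group modulo the radical of `n`. -/
theorem F_eq_prod_iff (n : ℕ) (hn : 1 < n) :
    F n = ∏ p ∈ n.primeFactors, (p - 1) ↔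
      ∀ v : (ZMod (∏ p ∈ n.primeFactors, p))ˣ, v ^ (n - 1) = 1 := by
  have : NeZero n := ⟨by lia⟩
  have : NeZero (∏ p ∈ n.primeFactors, p) :=
    ⟨(Finset.prod_pos fun p hp => (Nat.prime_of_mem_primeFactors hp).pos).ne'⟩
  set π := ZMod.unitsMap (Nat.prod_primeFactors_dvd n) with hπ
  have hsurj : Function.Surjective π := ZMod.unitsMap_surjective _
  set S := Finset.univ.filter fun u : (ZMod n)ˣ => u ^ (n - 1) = 1 with hS
  have hmem : ∀ u, u ∈ S ↔ u ^ (n - 1) = 1 := by simp [hS]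
  have hinj : Set.InjOn π S := by
    intro x hx y hy hxy
    rw [Finset.mem_coe, hmem] at hx hy
    have h1 : π (x / y) = 1 := by rw [map_div, hxy, div_self']
    have h2 := pow_eq_one_of_unitsMap_eq_one n _ h1
    rw [← mul_pow_sub_one (NeZero.ne n), div_pow, hx, hy, div_one, mul_one] at h2
    exact div_eq_one.1 h2
  rw [← prod_primeFactors_totient, ← ZMod.card_units_eq_totient, F_eq_card_units n hn, ← hS,
    ← Finset.card_image_of_injOn hinj, Finset.card_eq_iff_eq_univ, Finset.eq_univ_iff_forall]
  refine forall_congr' fun v => ?_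
  rw [Finset.mem_image]
  constructor
  · rintro ⟨u, hu, rfl⟩
    rw [← map_pow, (hmem u).1 hu, map_one]
  · intro hv
    obtain ⟨u, rfl⟩ := hsurj v
    refine ⟨u ^ n, ?_, ?_⟩
    · rw [hmem, ← pow_mul, mul_comm, pow_mul]
      exact pow_eq_one_of_unitsMap_eq_one n _ (by rw [map_pow, ← hπ, hv])
    · rw [map_pow, ← mul_pow_sub_one (NeZero.ne n), hv, mul_one]

theorem sum_pow_units (n : ℕ) [NeZero n] (hodd : Odd n)
    (h : ∀ v : (ZMod (∏ p ∈ n.primeFactors, p))ˣ, v ^ (n - 1) = 1) :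
    ∑ u : (ZMod n)ˣ, ((u ^ (n - 1) : (ZMod n)ˣ) : ZMod n) = n.totient := by
  have hpow : ∀ u : (ZMod n)ˣ, u ^ (n - 1) * u = u ^ n := fun u => pow_sub_one_mul (NeZero.ne n) u
  have hred : ∀ u : (ZMod n)ˣ, ZMod.castHom (Nat.prod_primeFactors_dvd n)
      (ZMod (∏ p ∈ n.primeFactors, p)) ((u ^ (n - 1) : (ZMod n)ˣ) : ZMod n) = 1 := fun u =>
    congrArg Units.val ((map_pow (ZMod.unitsMap (Nat.prod_primeFactors_dvd n)) u (n - 1)).trans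
      (h _))
  have hy : ∀ u : (ZMod n)ˣ, (u ^ (n - 1)) ^ n = 1 := fun u =>
    Units.ext (pow_eq_one_of_castHom_eq_one n _ (hred u))
  have hw : ∀ u : (ZMod n)ˣ, ∃ w : (ZMod n)ˣ,
      (w : ZMod n) = 2 - ((u ^ (n - 1) : (ZMod n)ˣ) : ZMod n) ∧ w ^ n = 1 := by
    intro u
    have h1 : (2 - ((u ^ (n - 1) : (ZMod n)ˣ) : ZMod n)) ^ n = 1 := by
      apply pow_eq_one_of_castHom_eq_one
      rw [map_sub, hred, map_ofNat]
      norm_num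
    exact ⟨(IsUnit.of_pow_eq_one h1 (NeZero.ne n)).unit, rfl, Units.ext h1⟩
  choose w hw1 hw2 using hw
  -- `σ` replaces `u ^ (n - 1) = 1 + z` by `1 - z`
  let σ : (ZMod n)ˣ → (ZMod n)ˣ := fun u => u * (u ^ (n - 1) / w u)
  have hσ : ∀ u, (σ u) ^ (n - 1) = w u := by
    intro u
    have h1 : (u ^ (n - 1) / w u) ^ (n - 1) * (u ^ (n - 1) / w u) = 1 := by
      rw [hpow, div_pow, hy, hw2, div_one]
    rw [mul_pow, eq_inv_of_mul_eq_one_left h1, inv_div, mul_div_cancel]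
  have hwσ : ∀ u, w (σ u) = u ^ (n - 1) := by
    intro u
    apply Units.ext
    rw [hw1, hσ, hw1]
    ring
  have hinv : Function.Involutive σ := by
    intro u
    change σ u * (σ u ^ (n - 1) / w (σ u)) = u
    rw [hσ, hwσ, mul_assoc, div_mul_div_cancel, div_self', mul_one]
  have hsum : ∑ u : (ZMod n)ˣ, ((u ^ (n - 1) : (ZMod n)ˣ) : ZMod n) =
      ∑ u : (ZMod n)ˣ, (2 - ((u ^ (n - 1) : (ZMod n)ˣ) : ZMod n)) :=
    (Equiv.sum_comp hinv.toPerm _).symm.trans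
      (Finset.sum_congr rfl fun u _ => by
        rw [← hw1, ← hσ]
        rfl)
  rw [Finset.sum_sub_distrib, Finset.sum_const, Finset.card_univ, ZMod.card_units_eq_totient,
    nsmul_eq_mul, eq_sub_iff_add_eq, ← mul_two] at hsum
  have h2 : IsUnit (2 : ZMod n) := by
    have := (ZMod.isUnit_iff_coprime 2 n).2 (Nat.coprime_two_left.2 hodd)
    exact_mod_cast this
  exact h2.mul_right_cancel hsum

theorem sub_one_dvd_of_sum_pow_units (n : ℕ) [NeZero n]
    (h : ∑ u : (ZMod n)ˣ, ((u ^ (n - 1) : (ZMod n)ˣ) : ZMod n) = n.totient) :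
    ∀ p ∈ n.primeFactors, p - 1 ∣ n - 1 := by
  have hmul : ∀ g : (ZMod n)ˣ,
      (((g ^ (n - 1) : (ZMod n)ˣ) : ZMod n) - 1) * n.totient = 0 := by
    intro g
    rw [sub_one_mul, sub_eq_zero, ← h, Finset.mul_sum]
    exact (Finset.sum_congr rfl fun u _ => by
      rw [← Units.val_mul, ← mul_pow]; rfl).trans
      (Equiv.sum_comp (Equiv.mulLeft g) fun u => ((u ^ (n - 1) : (ZMod n)ˣ) : ZMod n))
  by_contra! hbad
  obtain ⟨p₀, hp₀, hp₀'⟩ := hbad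
  obtain ⟨p, hp, hmax⟩ := Finset.exists_max_image
    (n.primeFactors.filter fun p => ¬ p - 1 ∣ n - 1) id ⟨p₀, Finset.mem_filter.2 ⟨hp₀, hp₀'⟩⟩
  obtain ⟨hpn, hpbad⟩ := Finset.mem_filter.1 hp
  have hpp := Nat.prime_of_mem_primeFactors hpn
  have hpd := Nat.dvd_of_mem_primeFactors hpn
  have : Fact p.Prime := ⟨hpp⟩
  have hv : ∃ v : (ZMod p)ˣ, v ^ (n - 1) ≠ 1 := by
    by_contra! hv
    have := (FiniteField.forall_pow_eq_one_iff (ZMod p) (n - 1)).1 hv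
    rw [ZMod.card] at this
    exact hpbad this
  obtain ⟨v, hv⟩ := hv
  obtain ⟨g, rfl⟩ := ZMod.unitsMap_surjective hpd v
  obtain ⟨a, ha⟩ := ZMod.intCast_surjective (g : ZMod n)
  have hna : (n : ℤ) ∣ (a ^ (n - 1) - 1) * n.totient := by
    rw [← ZMod.intCast_zmod_eq_zero_iff_dvd]
    push_cast
    rw [ha]
    simpa using hmul g
  have hpa : ¬ (p : ℤ) ∣ a ^ (n - 1) - 1 := by
    rw [← ZMod.intCast_zmod_eq_zero_iff_dvd]
    push_cast
    rw [sub_eq_zero]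
    intro h1
    apply hv
    have h2 : ((ZMod.unitsMap hpd g : (ZMod p)ˣ) : ZMod p) = a := by
      rw [ZMod.unitsMap_val, ← ha, ZMod.cast_intCast hpd]
    exact Units.ext (by rw [Units.val_pow_eq_pow_val, h2, h1, Units.val_one])
  obtain ⟨e, m, hpm, hnm⟩ := Nat.exists_eq_pow_mul_and_not_dvd (NeZero.ne n) p hpp.ne_one
  have hpe : p ^ e ∣ n.totient := by
    have h1 : ((p ^ e : ℕ) : ℤ) ∣ (a ^ (n - 1) - 1) * n.totient :=
      (Int.natCast_dvd_natCast.2 ⟨m, hnm⟩).trans hna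
    have h2 : IsCoprime ((p ^ e : ℕ) : ℤ) (a ^ (n - 1) - 1) := by
      push_cast
      exact ((Nat.prime_iff_prime_int.1 hpp).coprime_iff_not_dvd.2 hpa).pow_left
    exact Int.natCast_dvd_natCast.1 (h2.dvd_of_dvd_mul_left h1)
  have h3 : p ^ e * p ∣ p ^ e * (m * ∏ q ∈ n.primeFactors, (q - 1)) := by
    rw [← mul_assoc, ← hnm, ← Nat.totient_mul_prod_primeFactors]
    exact mul_dvd_mul hpe (Finset.dvd_prod_of_mem (fun q => q) hpn)
  have h4 := (hpp.dvd_mul.1 (Nat.dvd_of_mul_dvd_mul_left (pow_pos hpp.pos e) h3)).resolve_left hpm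
  obtain ⟨q, hq, hpq⟩ := (hpp.prime.dvd_finsetProd_iff _).1 h4
  have hqp := (Nat.prime_of_mem_primeFactors hq).two_le
  have hle := Nat.le_of_dvd (by lia) hpq
  have hgood : q - 1 ∣ n - 1 := by
    by_contra hq'
    have := hmax q (Finset.mem_filter.2 ⟨hq, hq'⟩)
    simp only [id] at this
    lia
  have h5 : p ∣ n - (n - 1) := Nat.dvd_sub hpd (hpq.trans hgood)
  have hn0 := Nat.pos_of_ne_zero (NeZero.ne n)
  rw [Nat.sub_sub_self hn0] at h5
  exact hpp.one_lt.ne' (Nat.dvd_one.1 h5)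

theorem pow_eq_one_of_forall_sub_one_dvd (n k : ℕ) (h : ∀ p ∈ n.primeFactors, p - 1 ∣ k)
    (v : (ZMod (∏ p ∈ n.primeFactors, p))ˣ) : v ^ k = 1 := by
  obtain ⟨a, ha⟩ := ZMod.intCast_surjective (v : ZMod (∏ p ∈ n.primeFactors, p))
  apply Units.ext
  rw [Units.val_pow_eq_pow_val, ← ha, Units.val_one, ← sub_eq_zero]
  have key : ((∏ p ∈ n.primeFactors, p : ℕ) : ℤ) ∣ a ^ k - 1 := by
    rw [Int.natCast_dvd]
    refine Finset.prod_primes_dvd _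
      (fun p hp => (Nat.prime_of_mem_primeFactors hp).prime) fun p hp => ?_
    have : Fact p.Prime := ⟨Nat.prime_of_mem_primeFactors hp⟩
    have hd : p ∣ ∏ p ∈ n.primeFactors, p := Finset.dvd_prod_of_mem (fun q => q) hp
    have h1 := (FiniteField.forall_pow_eq_one_iff (ZMod p) k).2
      (by rw [ZMod.card]; exact h p hp) (ZMod.unitsMap hd v)
    rw [← Int.natCast_dvd, ← ZMod.intCast_zmod_eq_zero_iff_dvd]
    have h2 := congrArg Units.val h1
    rw [Units.val_pow_eq_pow_val, ZMod.unitsMap_val, ← ha, ZMod.cast_intCast hd] at h2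
    push_cast
    rw [h2, Units.val_one, sub_self]
  rw [← ZMod.intCast_zmod_eq_zero_iff_dvd] at key
  exact_mod_cast key

theorem stmt_15 (n : ℕ) (hn : 1 < n) (hnp : ¬ n.Prime) :
    (Odd n → (IsWeakCarmichael n ↔ F n = ∏ p ∈ n.primeFactors, (p - 1))) ∧
      (IsCarmichael n ↔ F n = n.totient) := by
  have : NeZero n := ⟨by lia⟩
  refine ⟨fun hodd => ?_, ?_⟩
  · have hweak : IsWeakCarmichael n ↔
        ∑ u : (ZMod n)ˣ, ((u ^ (n - 1) : (ZMod n)ˣ) : ZMod n) = n.totient := by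
      rw [IsWeakCarmichael, ← ZMod.natCast_eq_natCast_iff, carmSum_cast]
      exact ⟨fun h => h.2.2, fun h => ⟨hn, hnp, h⟩⟩
    rw [hweak, F_eq_prod_iff n hn]
    exact ⟨fun h => pow_eq_one_of_forall_sub_one_dvd n _ (sub_one_dvd_of_sum_pow_units n h),
      sum_pow_units n hodd⟩
  · rw [F_eq_card_units n hn, ← ZMod.card_units_eq_totient, Finset.card_eq_iff_eq_univ,
      Finset.filter_eq_self]
    constructor
    · rintro ⟨-, -, h⟩ u -
      have h1 := h _ (ZMod.val_coe_unit_coprime u)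
      rw [← ZMod.natCast_eq_natCast_iff] at h1
      push_cast at h1
      rw [ZMod.natCast_zmod_val] at h1
      exact Units.ext h1
    · refine fun h => ⟨hn, hnp, fun a ha => ?_⟩
      have h1 := congrArg Units.val (h _ (Finset.mem_univ (ZMod.unitOfCoprime a ha)))
      rw [← ZMod.natCast_eq_natCast_iff]
      simpa using h1
end
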